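/- arXiv:math/0509537 — 2 statements merged into one kernel-verified Lean document; each statement's English description precedes it below -/
import Mathlib

section
/- Let 0 < μ_1 < ... < μ_r < 1 be rational numbers, write μ_i = p_i/q_i in lowest terms (gcd(p_i, q_i) = 1, p_i, q_i positive integers), and let M = lcm(q_1, ..., q_r). Then IV(0, μ_1, ..., μ_r, 1) = { 1 - 1/(M·t) : t ∈ ℕ, t ≥ 1 }. -/
/-- The average of the first `n` terms of a sequence `x` (terms `x 0, ..., x (n-1)`). -/
noncomputable def avgSeq (x : ℕ → ℝ) (n : ℕ) : ℝ := (∑ i ∈ Finset.range n, x i) / n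

/-- `IV A a b` : the set of "intermediate values" `P ∈ (a,b)` such that for every sequence with
terms in `A`, the consecutive averages cannot pass from below `P` to above `P` without hitting `P`
at an intermediate index. -/
def IV (A : Set ℝ) (a b : ℝ) : Set ℝ :=
  {P | P ∈ Set.Ioo a b ∧ ∀ x : ℕ → ℝ, (∀ n, x n ∈ A) →
    ∀ k l : ℕ, 1 ≤ k → k < l → avgSeq x k < P → P < avgSeq x l →
      ∃ s : ℕ, k < s ∧ s < l ∧ avgSeq x s = P}

/-- An integer sequence that decreases by at most one at each step and passes from a positive to a
negative value vanishes in between. -/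
theorem exists_eq_zero_of_sub_one_le (F : ℕ → ℤ) (hF : ∀ n, F n - 1 ≤ F (n + 1)) {k l : ℕ}
    (hkl : k < l) (hk : 0 < F k) (hl : F l < 0) : ∃ s, k < s ∧ s < l ∧ F s = 0 := by
  classical
  have hex : ∃ n, k < n ∧ F n ≤ 0 := ⟨l, hkl, hl.le⟩
  obtain ⟨hks, hs⟩ := Nat.find_spec hex
  have hmin : ∀ m < Nat.find hex, ¬ (k < m ∧ F m ≤ 0) := fun m hm => Nat.find_min hex hm
  have hle : Nat.find hex ≤ l := Nat.find_min' hex ⟨hkl, hl.le⟩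
  generalize Nat.find hex = s at *
  obtain ⟨m, rfl⟩ : ∃ m, s = m + 1 := ⟨s - 1, by omega⟩
  have hm : 0 < F m := by
    rcases eq_or_lt_of_le (Nat.lt_succ_iff.mp hks) with rfl | h
    · exact hk
    · have := hmin m (Nat.lt_succ_self m)
      push Not at this
      exact this h
  have h0 : F (m + 1) = 0 := by have := hF m; omega
  refine ⟨m + 1, hks, lt_of_le_of_ne hle ?_, h0⟩
  rintro rfl
  omega

/-- If every deficit `1 - y`, `y ∈ A`, is a natural multiple of `1 / M`, then all the numbers
`1 - 1 / (M * t)` in the unit interval are intermediate values. -/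
theorem one_sub_mem_IV {A : Set ℝ} {M t : ℕ} (hM : 2 ≤ M) (ht : 1 ≤ t)
    (hA : ∀ y ∈ A, ∃ e : ℕ, (M : ℝ) * (1 - y) = e) :
    1 - 1 / ((M : ℝ) * t) ∈ IV A 0 1 := by
  have hM' : (2 : ℝ) ≤ M := by exact_mod_cast hM
  have ht' : (1 : ℝ) ≤ t := by exact_mod_cast ht
  have hMt : 1 < (M : ℝ) * t := by nlinarith
  have hMt0 : 0 < (M : ℝ) * t := by linarith
  refine ⟨⟨?_, ?_⟩, ?_⟩
  · rw [sub_pos, div_lt_one hMt0]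
    exact hMt
  · have : 0 < 1 / ((M : ℝ) * t) := by positivity
    linarith
  intro x hx k l hk hkl hxk hxl
  choose e he using fun n => hA (x n) (hx n)
  let F : ℕ → ℤ := fun n => t * ∑ i ∈ Finset.range n, (e i : ℤ) - n
  have hsum : ∀ n, (F n : ℝ) = M * t * (n - ∑ i ∈ Finset.range n, x i) - n := by
    intro n
    have : ∑ i ∈ Finset.range n, (e i : ℝ) = M * (n - ∑ i ∈ Finset.range n, x i) := by
      simp_rw [← he, ← Finset.mul_sum, Finset.sum_sub_distrib]
      simp
    simp only [F]
    push_cast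
    rw [this]
    ring
  have hdiff : ∀ n : ℕ, 0 < n →
      (1 - 1 / ((M : ℝ) * t)) - avgSeq x n = F n / (M * t * n) := by
    intro n hn
    have hn' : (0 : ℝ) < n := by exact_mod_cast hn
    have hM0 : (M : ℝ) ≠ 0 := by linarith
    have ht0 : (t : ℝ) ≠ 0 := by linarith
    rw [hsum, avgSeq]
    field_simp
    ring
  have hpos : ∀ n : ℕ, 0 < n → 0 < (M : ℝ) * t * n := by
    intro n hn
    have : (0 : ℝ) < n := by exact_mod_cast hn
    positivity
  have hFk : 0 < F k := by
    have h := hdiff k hk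
    have h2 : 0 < (F k : ℝ) / (M * t * k) := by linarith
    exact_mod_cast (div_pos_iff_of_pos_right (hpos k hk)).mp h2
  have hFl : F l < 0 := by
    have h := hdiff l (by omega)
    have h2 : (F l : ℝ) / (M * t * l) < 0 := by linarith
    rw [div_lt_iff₀ (hpos l (by omega)), zero_mul] at h2
    exact_mod_cast h2
  obtain ⟨s, hks, hsl, hs⟩ := exists_eq_zero_of_sub_one_le F (fun n => by
    simp only [F, Finset.sum_range_succ]
    push_cast
    have : (0 : ℤ) ≤ t * e n := by positivity
    linarith) hkl hFk hFl
  refine ⟨s, hks, hsl, ?_⟩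
  have h := hdiff s (by omega)
  rw [hs] at h
  simp only [Int.cast_zero, zero_div] at h
  linarith

/-- If a sequence has eventually constant deficit `D`, then `D` is a natural multiple of `1 - P`
for every intermediate value `P` that is above the averages when the deficit stabilizes. -/
theorem exists_deficit_eq_of_mem_IV {A : Set ℝ} {P : ℝ} (hP : P ∈ IV A 0 1) {x : ℕ → ℝ}
    (hx : ∀ n, x n ∈ A) {K : ℕ} (hK : 1 ≤ K) {D : ℝ}
    (hD : ∀ n, K ≤ n → ∑ i ∈ Finset.range n, x i = n - D) (hKD : K * (1 - P) ≤ D) :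
    ∃ m : ℕ, D = m * (1 - P) := by
  obtain ⟨⟨hP0, hP1⟩, hiv⟩ := hP
  have hc : 0 < 1 - P := by linarith
  have hKle : (K : ℝ) ≤ D / (1 - P) := (le_div_iff₀ hc).mpr hKD
  have hKk : K ≤ ⌊D / (1 - P)⌋₊ := Nat.le_floor hKle
  have h1 := Nat.floor_le (le_trans (Nat.cast_nonneg K) hKle)
  have h2 := Nat.lt_floor_add_one (D / (1 - P))
  generalize ⌊D / (1 - P)⌋₊ = k at *
  rw [le_div_iff₀ hc] at h1
  rw [div_lt_iff₀ hc] at h2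
  by_contra! hne
  have h1' : k * (1 - P) < D := lt_of_le_of_ne h1 (hne k).symm
  have hk0 : (0 : ℝ) < k := by
    have : 0 < k := by omega
    exact_mod_cast this
  obtain ⟨s, hs1, hs2, -⟩ := hiv x hx k (k + 1) (by omega) (by omega)
    (by
      rw [avgSeq, hD k hKk, div_lt_iff₀ hk0]
      linarith)
    (by
      rw [avgSeq, hD (k + 1) (by omega), lt_div_iff₀ (by positivity)]
      push_cast
      linarith)
  omega

/-- If `0` and `1` are allowed terms and `P` is an intermediate value, then `1` and every deficit
`1 - y` of an allowed term `y ≤ 1` are integer multiples of `1 - P`. -/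
theorem exists_multiples_of_mem_IV {A : Set ℝ} {P : ℝ} (hP : P ∈ IV A 0 1) (h0 : 0 ∈ A)
    (h1 : 1 ∈ A) :
    ∃ m : ℕ, 1 = m * (1 - P) ∧ ∀ y ∈ A, y ≤ 1 → ∃ j : ℤ, 1 - y = j * (1 - P) := by
  have hP0 : 0 < P := hP.1.1
  have hP1 : P < 1 := hP.1.2
  obtain ⟨m, hm⟩ := exists_deficit_eq_of_mem_IV hP (x := fun n => if n = 0 then 0 else 1)
    (fun n => by split_ifs <;> assumption) le_rfl (D := 1)
    (fun n hn => by
      obtain ⟨n, rfl⟩ := Nat.exists_eq_add_of_le' hn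
      rw [Finset.sum_range_succ']
      simp)
    (by push_cast; linarith)
  refine ⟨m, hm, fun y hy hy1 => ?_⟩
  have hm2 : (2 : ℝ) ≤ m := by
    have : 1 < m := by
      by_contra! h
      have : (m : ℝ) ≤ 1 := by exact_mod_cast h
      nlinarith
    exact_mod_cast this
  obtain ⟨j, hj⟩ := exists_deficit_eq_of_mem_IV hP
    (x := fun n => if n = 0 then 0 else if n = 1 then y else 1)
    (fun n => by split_ifs <;> assumption) (K := 2) (by norm_num) (D := 1 + (1 - y))
    (fun n hn => by
      obtain ⟨n, rfl⟩ := Nat.exists_eq_add_of_le' hn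
      rw [Finset.sum_range_succ', Finset.sum_range_succ']
      simp
      ring)
    (by push_cast; nlinarith)
  refine ⟨j - m, ?_⟩
  push_cast
  linarith

/-- THEOREM 7: if `0 < μ_1 < ... < μ_r < 1` are rationals with `μ_i = p_i/q_i` in lowest terms
and `M = lcm(q_1, ..., q_r)`, then `IV(0, μ_1, ..., μ_r, 1) = { 1 - 1/(M·t) : t ≥ 1 }`. -/
theorem IV_multi_rational (r : ℕ) (hr : 1 ≤ r) (μ : ℕ → ℝ) (p q : ℕ → ℕ)
    (hmono : ∀ i j, 1 ≤ i → i < j → j ≤ r → μ i < μ j)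
    (hbounds : ∀ i, 1 ≤ i → i ≤ r → 0 < μ i ∧ μ i < 1)
    (hfrac : ∀ i, 1 ≤ i → i ≤ r →
      0 < p i ∧ 0 < q i ∧ Nat.Coprime (p i) (q i) ∧ μ i = (p i : ℝ) / q i) :
    IV (insert 0 (insert 1 {y : ℝ | ∃ i, 1 ≤ i ∧ i ≤ r ∧ y = μ i})) 0 1 =
      {y : ℝ | ∃ t : ℕ, 1 ≤ t ∧ y = 1 - 1 / ((((Finset.Icc 1 r).lcm q : ℕ) : ℝ) * t)} := by
  have hM0 : (Finset.Icc 1 r).lcm q ≠ 0 := by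
    rw [Ne, Finset.lcm_eq_zero_iff]
    rintro ⟨i, hi, hqi⟩
    rw [Finset.mem_Icc] at hi
    have := (hfrac i hi.1 hi.2).2.1
    omega
  have hdvd : ∀ i, 1 ≤ i → i ≤ r → q i ∣ (Finset.Icc 1 r).lcm q := fun i h1 h2 =>
    Finset.dvd_lcm (Finset.mem_Icc.mpr ⟨h1, h2⟩)
  have hpq : ∀ i, 1 ≤ i → i ≤ r → p i < q i := by
    intro i h1 h2
    obtain ⟨-, hq, -, hμ⟩ := hfrac i h1 h2
    have h := (hbounds i h1 h2).2
    rw [hμ, div_lt_one (by exact_mod_cast hq)] at h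
    exact_mod_cast h
  have hM2 : 2 ≤ (Finset.Icc 1 r).lcm q := by
    have h1 := hpq 1 le_rfl hr
    have h2 := (hfrac 1 le_rfl hr).1
    have h3 := Nat.le_of_dvd (Nat.pos_of_ne_zero hM0) (hdvd 1 le_rfl hr)
    omega
  ext P
  constructor
  · intro hP
    obtain ⟨m, hm, hmul⟩ := exists_multiples_of_mem_IV hP (by simp) (by simp)
    have hP1 : P < 1 := hP.1.2
    have hm0 : (m : ℝ) ≠ 0 := by
      intro h
      rw [h] at hm
      linarith
    have hMm : (Finset.Icc 1 r).lcm q ∣ m := by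
      refine Finset.lcm_dvd fun i hi => ?_
      rw [Finset.mem_Icc] at hi
      obtain ⟨-, hq, hcop, hμ⟩ := hfrac i hi.1 hi.2
      obtain ⟨j, hj⟩ := hmul (μ i) (Or.inr (Or.inr ⟨i, hi.1, hi.2, rfl⟩))
        (hbounds i hi.1 hi.2).2.le
      have hq' : (q i : ℝ) ≠ 0 := by exact_mod_cast hq.ne'
      have hP' : 1 - P = 1 / m := by
        field_simp
        linarith
      have hreal : (m : ℝ) * p i = q i * (m - j) := by
        rw [hP', hμ] at hj
        field_simp at hj
        linarith
      have hint : (m : ℤ) * p i = q i * (m - j) := by exact_mod_cast hreal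
      have hd : (q i : ℤ) ∣ ((m * p i : ℕ) : ℤ) := ⟨m - j, by push_cast; exact hint⟩
      exact hcop.symm.dvd_of_dvd_mul_right (Int.natCast_dvd_natCast.mp hd)
    obtain ⟨t, rfl⟩ := hMm
    refine ⟨t, Nat.one_le_iff_ne_zero.mpr ?_, ?_⟩
    · rintro rfl
      simp at hm0
    · push_cast at hm hm0
      have : 1 - P = 1 / ((((Finset.Icc 1 r).lcm q : ℕ) : ℝ) * t) := by
        rw [eq_div_iff hm0]
        linarith
      linarith
  · rintro ⟨t, ht, rfl⟩
    refine one_sub_mem_IV hM2 ht ?_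
    rintro y (rfl | rfl | ⟨i, h1, h2, rfl⟩)
    · exact ⟨(Finset.Icc 1 r).lcm q, by ring⟩
    · exact ⟨0, by simp⟩
    · obtain ⟨d, hd⟩ := hdvd i h1 h2
      obtain ⟨-, hq, -, hμ⟩ := hfrac i h1 h2
      have hq' : (q i : ℝ) ≠ 0 := by exact_mod_cast hq.ne'
      refine ⟨(q i - p i) * d, ?_⟩
      rw [hd, hμ]
      push_cast [(hpq i h1 h2).le]
      field_simp
end

section
/- Let 0 < μ_1 < ... < μ_r < 1 be rational numbers with μ_i = p_i/q_i in lowest terms, let M = lcm(q_1, ..., q_r), and let t ≥ 1 be an integer. Then 1 - 1/(M·t) belongs to IV(0, μ_1, ..., μ_r, 1): for every sequence {x_n} with all terms in {0, μ_1, ..., μ_r, 1}, the consecutive averages cannot increase from a value below 1 - 1/(M·t) to a value above it without taking the value 1 - 1/(M·t) at some intermediate index. -/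
/-- An integer sequence that increases by at most one at each step cannot pass from negative to
positive values without vanishing in between. -/
theorem exists_eq_zero_of_step_le_one (g : ℕ → ℤ) (hg : ∀ n, g (n + 1) ≤ g n + 1) {k l : ℕ}
    (hkl : k < l) (hk : g k < 0) (hl : 0 < g l) : ∃ s, k < s ∧ s < l ∧ g s = 0 := by
  induction l, hkl using Nat.le_induction with
  | base => exact absurd (hg k) (by simp only [Nat.succ_eq_add_one] at hl; omega)
  | succ m hm ih =>
    have hstep := hg m
    rcases (show g m = 0 ∨ 0 < g m by omega) with h | h
    · refine ⟨m, ?_, by omega, h⟩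
      exact hm
    · obtain ⟨s, h1, h2, h3⟩ := ih h
      exact ⟨s, h1, by omega, h3⟩

/-- If every element of `A` is at most `1` and becomes an integer after multiplication by `M`,
then `1 - 1 / (M * t)` is an intermediate value for `A`. -/
theorem one_sub_one_div_mem_IV {A : Set ℝ} {M t : ℕ} (hM : 1 < M) (ht : 1 ≤ t)
    (hA : ∀ y ∈ A, y ≤ 1 ∧ ∃ c : ℤ, (M : ℝ) * (1 - y) = c) :
    (1 - 1 / ((M : ℝ) * t)) ∈ IV A 0 1 := by
  have hM' : (1 : ℝ) < M := by exact_mod_cast hM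
  have ht' : (1 : ℝ) ≤ t := by exact_mod_cast ht
  have hMt : (1 : ℝ) < M * t := by nlinarith
  refine ⟨⟨?_, ?_⟩, ?_⟩
  · have : 1 / ((M : ℝ) * t) < 1 := by rw [div_lt_one (by linarith)]; exact hMt
    linarith
  · have : 0 < 1 / ((M : ℝ) * t) := by positivity
    linarith
  intro x hx k l hk hkl hxk hxl
  choose c hc using fun n => (hA (x n) (hx n)).2
  have hc0 : ∀ n, 0 ≤ c n := fun n => by
    have h1 := (hA (x n) (hx n)).1
    have h2 : (0 : ℝ) ≤ c n := by
      rw [← hc n]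
      exact mul_nonneg (by linarith) (by linarith)
    exact_mod_cast h2
  let g : ℕ → ℤ := fun n => n - t * ∑ i ∈ Finset.range n, c i
  have havg : ∀ n, 1 ≤ n →
      avgSeq x n = (1 - 1 / ((M : ℝ) * t)) + (g n : ℝ) / (M * n * t) := by
    intro n hn
    have hn' : (n : ℝ) ≠ 0 := by positivity
    have hsum : ∑ i ∈ Finset.range n, (c i : ℝ) = M * (n - ∑ i ∈ Finset.range n, x i) := by
      simp_rw [← hc]
      rw [← Finset.mul_sum, Finset.sum_sub_distrib]
      simp
    have hM0 : (M : ℝ) ≠ 0 := by positivity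
    have ht0 : (t : ℝ) ≠ 0 := by positivity
    simp only [avgSeq, g]
    push_cast
    rw [hsum]
    field_simp
    ring
  have hpos : ∀ n : ℕ, 1 ≤ n → (0 : ℝ) < M * n * t := fun n hn => by positivity
  have hgk : g k < 0 := by
    rw [havg k hk] at hxk
    have h : (g k : ℝ) / (M * k * t) < 0 := by linarith
    rw [div_lt_iff₀ (hpos k hk), zero_mul] at h
    exact_mod_cast h
  have hgl : 0 < g l := by
    have hl : 1 ≤ l := by omega
    rw [havg l hl] at hxl
    have h : 0 < (g l : ℝ) / (M * l * t) := by linarith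
    rw [lt_div_iff₀ (hpos l hl), zero_mul] at h
    exact_mod_cast h
  have hstep : ∀ n, g (n + 1) ≤ g n + 1 := by
    intro n
    have h : 0 ≤ (t : ℤ) * c n := mul_nonneg (by positivity) (hc0 n)
    simp only [g, Finset.sum_range_succ, mul_add]
    push_cast
    linarith
  obtain ⟨s, h1, h2, h3⟩ := exists_eq_zero_of_step_le_one g hstep hkl hgk hgl
  refine ⟨s, h1, h2, ?_⟩
  rw [havg s (by omega), h3]
  simp

/-- If `0 < μ_1 < ... < μ_r < 1` are rationals with `μ_i = p_i/q_i` in lowest terms,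
`M = lcm(q_1, ..., q_r)` and `t ≥ 1`, then `1 - 1/(M·t)` belongs to
`IV(0, μ_1, ..., μ_r, 1)`. -/
theorem frac_mem_IV_multi (r : ℕ) (hr : 1 ≤ r) (μ : ℕ → ℝ) (p q : ℕ → ℕ)
    (hmono : ∀ i j, 1 ≤ i → i < j → j ≤ r → μ i < μ j)
    (hbounds : ∀ i, 1 ≤ i → i ≤ r → 0 < μ i ∧ μ i < 1)
    (hfrac : ∀ i, 1 ≤ i → i ≤ r →
      0 < p i ∧ 0 < q i ∧ Nat.Coprime (p i) (q i) ∧ μ i = (p i : ℝ) / q i)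
    (t : ℕ) (ht : 1 ≤ t) :
    (1 - 1 / ((((Finset.Icc 1 r).lcm q : ℕ) : ℝ) * t)) ∈
      IV (insert 0 (insert 1 {y : ℝ | ∃ i, 1 ≤ i ∧ i ≤ r ∧ y = μ i})) 0 1 := by
  have hdvd : ∀ i, 1 ≤ i → i ≤ r → q i ∣ (Finset.Icc 1 r).lcm q := fun i h1 h2 =>
    Finset.dvd_lcm (Finset.mem_Icc.2 ⟨h1, h2⟩)
  have hM0 : (Finset.Icc 1 r).lcm q ≠ 0 := by
    rw [Ne, Finset.lcm_eq_zero_iff]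
    rintro ⟨i, hi, h⟩
    have hi' := Finset.mem_Icc.1 hi
    exact (hfrac i hi'.1 hi'.2).2.1.ne' h
  refine one_sub_one_div_mem_IV ?_ ht ?_
  · obtain ⟨hp, hq, -, hμ⟩ := hfrac 1 le_rfl hr
    have hlt := (hbounds 1 le_rfl hr).2
    rw [hμ, div_lt_one (by exact_mod_cast hq)] at hlt
    have hpq : p 1 < q 1 := by exact_mod_cast hlt
    have hle := Nat.le_of_dvd (Nat.pos_of_ne_zero hM0) (hdvd 1 le_rfl hr)
    omega
  · rintro y (rfl | rfl | ⟨i, h1, h2, rfl⟩)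
    · exact ⟨zero_le_one, ((Finset.Icc 1 r).lcm q : ℕ), by simp⟩
    · exact ⟨le_rfl, 0, by simp⟩
    · refine ⟨(hbounds i h1 h2).2.le, ?_⟩
      obtain ⟨-, hq, -, hμ⟩ := hfrac i h1 h2
      obtain ⟨d, hd⟩ := hdvd i h1 h2
      refine ⟨d * (q i - p i), ?_⟩
      have hq' : (q i : ℝ) ≠ 0 := by positivity
      rw [hd, hμ]
      push_cast
      field_simp
end
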